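/- Let d = 2. Let (X_t)_{t≥0} be a jointly measurable stationary ℝ²-valued process on a probability space whose one-dimensional marginal has a bounded density μ with respect to Lebesgue measure, with μ in the anisotropic Hölder class H_2(β, L), β = (β_1, β_2), β_i > 0. Assume there is a constant C₀ such that for every T > 0 and every bounded measurable f : ℝ² → ℝ whose support S has Lebesgue measure |S| < 1: Var(∫_0^T f(X_t) dt) ≤ C₀ T ‖f‖_∞² |S|² (1 + log(1/|S|)). Let K be a kernel function satisfying ∫_ℝ K = 1, ‖K‖_∞ < ∞, supp(K) ⊆ [−1,1], ∫_ℝ K(x) x^l dx = 0 for l ∈ {1,…,M}, with M ≥ max(β_1, β_2), and define μ̂_{h,T}(x) = (1/(T h_1 h_2)) ∫_0^T K((x_1 − X_u^1)/h_1) K((x_2 − X_u^2)/h_2) du. Then there is a constant C, independent of x, T and h, such that: (i) for every x ∈ ℝ², T > 0 and h_1, h_2 ∈ (0, 1/2], E[|μ̂_{h,T}(x) − μ(x)|²] ≤ C ( h_1^{2β_1} + h_2^{2β_2} + T^{−1} (1 + log(1/(h_1 h_2))) ); (ii) for any a_1, a_2 ∈ (0,1] with 2a_iβ_i > 1, taking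 h_i = T^{−a_i}, one has E[|μ̂_{h,T}(x) − μ(x)|²] ≤ C (log T)/T for all sufficiently large T and all x ∈ ℝ². -/

import Mathlib

open Real MeasureTheory Finset

/-- Iterated partial derivative in coordinate direction `i`. -/
noncomputable def pderivIter (d : ℕ) (i : Fin d) :
    ℕ → (EuclideanSpace ℝ (Fin d) → ℝ) → EuclideanSpace ℝ (Fin d) → ℝ
  | 0, g => g
  | k + 1, g => fun x => fderiv ℝ (pderivIter d i k g) x (EuclideanSpace.single i 1)

/-- Largest integer strictly smaller than `b` (for `b > 0`). -/
noncomputable def flr (b : ℝ) : ℕ := ⌈b⌉₊ - 1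

/-- The anisotropic Hölder class `H_d(β, L)`. -/
def memHolder (d : ℕ) (β L : Fin d → ℝ) (g : EuclideanSpace ℝ (Fin d) → ℝ) : Prop :=
  ∀ i : Fin d,
    (∀ k ≤ flr (β i), ∀ x, |pderivIter d i k g x| ≤ L i) ∧
    (∀ k < flr (β i), Differentiable ℝ (pderivIter d i k g)) ∧
    (∀ t : ℝ, ∀ x, |pderivIter d i (flr (β i)) g (x + t • EuclideanSpace.single i 1)
        - pderivIter d i (flr (β i)) g x| ≤ L i * |t| ^ (β i - (flr (β i) : ℝ)))


lemma taylor_aux (γ Lc : ℝ) (hγ : 0 < γ) (hL : 0 ≤ Lc) :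
    ∀ (n : ℕ) (G : ℕ → ℝ → ℝ), (∀ k < n, ∀ t, HasDerivAt (G k) (G (k + 1) t) t) →
      (∀ t, |G n t - G n 0| ≤ Lc * |t| ^ γ) →
      ∀ t, |G 0 t - ∑ k ∈ Finset.range (n + 1), G k 0 * (t ^ k / (k.factorial : ℝ))|
        ≤ Lc * |t| ^ (γ + n) := by
  intro n
  induction n with
  | zero =>
    intro G _ h t
    simpa using h t
  | succ n ih =>
    intro G hd h t
    have ih' := ih (fun k => G (k + 1)) (fun k hk s => hd (k + 1) (by omega) s) h
    set R : ℝ → ℝ := fun s => G 0 s - ∑ k ∈ Finset.range (n + 1 + 1), G k 0 * (s ^ k / (k.factorial : ℝ)) with hR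
    have hRd : ∀ s, HasDerivAt R
        (G 1 s - ∑ k ∈ Finset.range (n + 1), G (k + 1) 0 * (s ^ k / (k.factorial : ℝ))) s := by
      intro s
      have h1 : HasDerivAt (fun s : ℝ => ∑ k ∈ Finset.range (n + 1 + 1), G k 0 * (s ^ k / (k.factorial : ℝ)))
          (∑ k ∈ Finset.range (n + 1 + 1), G k 0 * ((k : ℝ) * s ^ (k - 1) / (k.factorial : ℝ))) s := by
        apply HasDerivAt.fun_sum
        intro k _
        exact ((hasDerivAt_pow k s).div_const _).const_mul _
      have h2 : (∑ k ∈ Finset.range (n + 1 + 1), G k 0 * ((k : ℝ) * s ^ (k - 1) / (k.factorial : ℝ)))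
          = ∑ k ∈ Finset.range (n + 1), G (k + 1) 0 * (s ^ k / (k.factorial : ℝ)) := by
        rw [Finset.sum_range_succ']
        simp only [Nat.cast_zero, zero_mul, zero_div, mul_zero, add_zero]
        apply Finset.sum_congr rfl
        intro k _
        rw [Nat.factorial_succ]
        have : (k.factorial : ℝ) ≠ 0 := by positivity
        have : ((k : ℝ) + 1) ≠ 0 := by positivity
        push_cast
        field_simp
      rw [← h2]
      exact (hd 0 (by omega) s).sub h1
    have hR0 : R 0 = 0 := by
      simp only [hR]
      rw [Finset.sum_range_succ']
      simp
    have key := Convex.norm_image_sub_le_of_norm_hasDerivWithin_le (s := Set.uIcc 0 t)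
      (f := R) (C := Lc * |t| ^ (γ + n)) (x := 0) (y := t)
      (fun s _ => (hRd s).hasDerivWithinAt) (fun s hs => by
        rw [Real.norm_eq_abs]
        refine (ih' s).trans ?_
        have : |s| ≤ |t| := by
          have := Set.abs_sub_left_of_mem_uIcc hs
          simpa using this
        gcongr) (convex_uIcc 0 t) Set.left_mem_uIcc Set.right_mem_uIcc
    rw [hR0, sub_zero, sub_zero, Real.norm_eq_abs, Real.norm_eq_abs] at key
    refine key.trans (le_of_eq ?_)
    have : γ + ((n + 1 : ℕ) : ℝ) = (γ + n) + 1 := by push_cast; ring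
    rw [this, Real.rpow_add_one' (abs_nonneg t) (by positivity)]
    ring

lemma K_int_aux (K : ℝ → ℝ) (hK_meas : Measurable K) (MK : ℝ) (hK_bdd : ∀ x, |K x| ≤ MK)
    (hK_supp : Function.support K ⊆ Set.Icc (-1) 1) : Integrable K := by
  rw [← integrableOn_iff_integrable_of_support_subset hK_supp]
  exact Measure.integrableOn_of_bounded (M := MK) (by simp) hK_meas.aestronglyMeasurable
    (Filter.Eventually.of_forall fun x => by simpa using hK_bdd x)

lemma K_bound_aux (K : ℝ → ℝ) (MK : ℝ) (hK_bdd : ∀ x, |K x| ≤ MK)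
    (hK_supp : Function.support K ⊆ Set.Icc (-1) 1) (F : ℝ → ℝ) (B : ℝ)
    (hF : ∀ u ∈ Set.Icc (-1 : ℝ) 1, |F u| ≤ B) : |∫ u, K u * F u| ≤ 2 * MK * B := by
  have hMK : 0 ≤ MK := (abs_nonneg _).trans (hK_bdd 0)
  have hs : Function.support (fun u => K u * F u) ⊆ Set.Icc (-1) 1 := by
    intro u hu
    apply hK_supp
    intro h
    exact hu (by simp [h])
  rw [← setIntegral_eq_integral_of_forall_compl_eq_zero (s := Set.Icc (-1 : ℝ) 1)
    (fun u hu => by by_contra h; exact hu (hs h))]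
  have := norm_setIntegral_le_of_norm_le_const (μ := volume) (s := Set.Icc (-1 : ℝ) 1)
    (f := fun u => K u * F u) (C := MK * B) (by simp) (fun u hu => by
      rw [Real.norm_eq_abs, abs_mul]
      exact mul_le_mul (hK_bdd u) (hF u hu) (abs_nonneg _) hMK)
  rw [Real.norm_eq_abs] at this
  refine this.trans (le_of_eq ?_)
  simp [Measure.real]
  norm_num
  ring

lemma bias_1d (K : ℝ → ℝ) (hK_meas : Measurable K) (hK_int : ∫ x, K x = 1)
    (MK : ℝ) (hK_bdd : ∀ x, |K x| ≤ MK)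
    (hK_supp : Function.support K ⊆ Set.Icc (-1) 1) (M : ℕ)
    (hK_mom : ∀ l : ℕ, 1 ≤ l → l ≤ M → ∫ x, K x * x ^ l = 0)
    (γ Lc : ℝ) (hγ : 0 < γ) (hL : 0 ≤ Lc) (n : ℕ) (hn : n ≤ M) (G : ℕ → ℝ → ℝ)
    (hd : ∀ k < n, ∀ t, HasDerivAt (G k) (G (k + 1) t) t)
    (hh : ∀ t, |G n t - G n 0| ≤ Lc * |t| ^ γ)
    (hG : Measurable (G 0)) (B : ℝ) (hB : ∀ t, |G 0 t| ≤ B) (h : ℝ) (h0 : 0 < h) :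
    |(∫ u, K u * G 0 (-(h * u))) - G 0 0| ≤ 2 * MK * (Lc * h ^ (γ + n)) := by
  have hKi := K_int_aux K hK_meas MK hK_bdd hK_supp
  have hpow : ∀ k : ℕ, Integrable (fun u => K u * u ^ k) := by
    intro k
    have : Integrable (fun u => |K u|) := hKi.abs
    refine this.mono' (by fun_prop)
      (Filter.Eventually.of_forall fun u => ?_)
    rw [Real.norm_eq_abs, abs_mul]
    by_cases hu : K u = 0
    · simp [hu]
    · have := hK_supp hu
      have h1 : |u| ≤ 1 := abs_le.2 this
      rw [abs_pow]
      exact mul_le_of_le_one_right (abs_nonneg _) (pow_le_one₀ (abs_nonneg _) h1)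
  have hterm : ∀ k : ℕ, Integrable (fun u => G k 0 * ((-h) ^ k / (k.factorial : ℝ)) * (K u * u ^ k)) :=
    fun k => (hpow k).const_mul _
  have hsum : ∫ u, K u * ∑ k ∈ Finset.range (n + 1), G k 0 * ((-(h * u)) ^ k / (k.factorial : ℝ))
      = G 0 0 := by
    have : (fun u => K u * ∑ k ∈ Finset.range (n + 1), G k 0 * ((-(h * u)) ^ k / (k.factorial : ℝ)))
      = fun u => ∑ k ∈ Finset.range (n + 1), G k 0 * ((-h) ^ k / (k.factorial : ℝ)) * (K u * u ^ k) := by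
      funext u
      rw [Finset.mul_sum]
      apply Finset.sum_congr rfl
      intro k _
      rw [show -(h * u) = (-h) * u by ring, mul_pow]
      ring
    rw [this, integral_finsetSum _ (fun k _ => hterm k), Finset.sum_range_succ']
    simp only [integral_const_mul]
    rw [Finset.sum_eq_zero]
    · simp [hK_int]
    · intro k hk
      rw [hK_mom (k + 1) (by omega) (by have := Finset.mem_range.1 hk; omega), mul_zero]
  have hsi : Integrable (fun u => K u * ∑ k ∈ Finset.range (n + 1), G k 0 * ((-(h * u)) ^ k / (k.factorial : ℝ))) := by
    have : (fun u => K u * ∑ k ∈ Finset.range (n + 1), G k 0 * ((-(h * u)) ^ k / (k.factorial : ℝ)))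
      = fun u => ∑ k ∈ Finset.range (n + 1), G k 0 * ((-h) ^ k / (k.factorial : ℝ)) * (K u * u ^ k) := by
      funext u
      rw [Finset.mul_sum]
      apply Finset.sum_congr rfl
      intro k _
      rw [show -(h * u) = (-h) * u by ring, mul_pow]
      ring
    rw [this]
    exact integrable_finsetSum _ (fun k _ => hterm k)
  have hgi : Integrable (fun u => K u * G 0 (-(h * u))) :=
    hKi.mul_bdd (c := B) (hG.comp (by fun_prop)).aestronglyMeasurable
      (Filter.Eventually.of_forall fun u => by simpa using hB _)
  rw [← hsum, ← integral_sub hgi hsi]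
  simp_rw [← mul_sub]
  apply K_bound_aux K MK hK_bdd hK_supp
  intro u hu
  refine (taylor_aux γ Lc hγ hL n G hd hh _).trans ?_
  have h1 : |u| ≤ 1 := abs_le.2 hu
  have : |-(h * u)| ≤ h := by
    rw [abs_neg, abs_mul, abs_of_pos h0]
    exact mul_le_of_le_one_right h0.le h1
  gcongr

lemma cov_1d (F : ℝ → ℝ) (x h : ℝ) (h0 : 0 < h) : ∫ a, F a = h * ∫ u, F (x - h * u) := by
  have := Measure.integral_comp_mul_left (fun v => F (x - v)) h
  rw [this, integral_sub_left_eq_self F volume x, abs_of_pos (inv_pos.2 h0), smul_eq_mul]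
  field_simp

lemma log_aux (s A : ℝ) (hs : 0 ≤ s) (hA : 0 < A) (hsA : s ≤ A) (hA1 : A ≤ 1) :
    s ^ 2 * (1 + Real.log (1 / s)) ≤ A ^ 2 * (1 + Real.log (1 / A)) := by
  have hlA : 0 ≤ Real.log (1 / A) := Real.log_nonneg (by rw [le_div_iff₀ hA]; linarith)
  rcases hs.eq_or_lt with rfl | hs
  · simp only [ne_eq, OfNat.ofNat_ne_zero, not_false_eq_true, zero_pow, zero_mul]; positivity
  have h1 : Real.log (1 / s) = Real.log (1 / A) + Real.log (A / s) := by
    rw [← Real.log_mul (by positivity) (by positivity)]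
    congr 1
    field_simp
  have h2 : Real.log (A / s) ≤ A / s - 1 := Real.log_le_sub_one_of_pos (by positivity)
  have h3 : s ^ 2 * (1 + Real.log (1 / s)) ≤ s ^ 2 * Real.log (1 / A) + s * A := by
    rw [h1]
    have : s ^ 2 * (1 + (Real.log (1 / A) + Real.log (A / s))) ≤
      s ^ 2 * (1 + (Real.log (1 / A) + (A / s - 1))) := by gcongr
    refine this.trans (le_of_eq ?_)
    field_simp
    ring
  have h4 : s ^ 2 ≤ A ^ 2 := by gcongr
  nlinarith [mul_le_mul_of_nonneg_right h4 hlA]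

lemma flr_aux (b : ℝ) (hb : 0 < b) : (flr b : ℝ) < b := by
  unfold flr
  have h : 0 < ⌈b⌉₊ := Nat.ceil_pos.2 hb
  have := Nat.ceil_lt_add_one hb.le
  rw [Nat.cast_sub (by omega)]
  push_cast
  linarith

lemma slice_bias (K : ℝ → ℝ) (hK_meas : Measurable K) (hK_int : ∫ x, K x = 1)
    (MK : ℝ) (hK_bdd : ∀ x, |K x| ≤ MK)
    (hK_supp : Function.support K ⊆ Set.Icc (-1) 1) (M : ℕ)
    (hK_mom : ∀ l : ℕ, 1 ≤ l → l ≤ M → ∫ x, K x * x ^ l = 0)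
    (β L : Fin 2 → ℝ) (hβ : ∀ i, 0 < β i) (hL : ∀ i, 0 < L i) (hM : ∀ i, β i ≤ (M : ℝ))
    (μ : EuclideanSpace ℝ (Fin 2) → ℝ) (hμ_meas : Measurable μ) (Cμ : ℝ)
    (hb : ∀ x, |μ x| ≤ Cμ) (hH : memHolder 2 β L μ) (i : Fin 2)
    (z : EuclideanSpace ℝ (Fin 2)) (h : ℝ) (h0 : 0 < h) :
    |(∫ u, K u * μ (z + (-(h * u)) • EuclideanSpace.single i 1)) - μ z|
      ≤ 2 * MK * (L i * h ^ β i) := by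
  obtain ⟨_, hd, hh⟩ := hH i
  have hf := flr_aux (β i) (hβ i)
  have hline : ∀ t : ℝ, HasDerivAt (fun t : ℝ => z + t • (EuclideanSpace.single i 1 : EuclideanSpace ℝ (Fin 2)))
      (EuclideanSpace.single i 1) t := by
    intro t
    simpa using ((hasDerivAt_id t).smul_const (EuclideanSpace.single i 1 : EuclideanSpace ℝ (Fin 2))).const_add z
  have := bias_1d K hK_meas hK_int MK hK_bdd hK_supp M hK_mom (β i - flr (β i)) (L i)
    (by linarith) (hL i).le (flr (β i)) (by have := hM i; exact_mod_cast (hf.trans_le this).le)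
    (fun k t => pderivIter 2 i k μ (z + t • EuclideanSpace.single i 1))
    (fun k hk t => by
      have := ((hd k hk) (z + t • EuclideanSpace.single i 1)).hasFDerivAt.comp_hasDerivAt t (hline t)
      exact this)
    (fun t => by simpa using hh t z)
    (by
      show Measurable fun t : ℝ => μ (z + t • EuclideanSpace.single i 1)
      exact hμ_meas.comp (by fun_prop)) Cμ (fun t => hb _) h h0
  simpa [pderivIter] using this

lemma mp_aux : ∃ e : ℝ × ℝ ≃ᵐ EuclideanSpace ℝ (Fin 2), MeasurePreserving e volume volume ∧
    ∀ p, e p = !₂[p.1, p.2] := by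
  refine ⟨MeasurableEquiv.finTwoArrow.symm.trans (MeasurableEquiv.toLp 2 (Fin 2 → ℝ)), ?_, ?_⟩
  · exact (MeasureTheory.volume_preserving_finTwoArrow ℝ).symm.trans
      (PiLp.volume_preserving_toLp (Fin 2))
  · intro p
    rfl

lemma bias_2d (K : ℝ → ℝ) (hK_meas : Measurable K) (hK_int : ∫ x, K x = 1)
    (MK : ℝ) (hK_bdd : ∀ x, |K x| ≤ MK)
    (hK_supp : Function.support K ⊆ Set.Icc (-1) 1) (M : ℕ)
    (hK_mom : ∀ l : ℕ, 1 ≤ l → l ≤ M → ∫ x, K x * x ^ l = 0)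
    (β L : Fin 2 → ℝ) (hβ : ∀ i, 0 < β i) (hL : ∀ i, 0 < L i) (hM : ∀ i, β i ≤ (M : ℝ))
    (μ : EuclideanSpace ℝ (Fin 2) → ℝ) (hμ_meas : Measurable μ) (Cμ : ℝ)
    (hb : ∀ x, |μ x| ≤ Cμ) (hH : memHolder 2 β L μ)
    (x : EuclideanSpace ℝ (Fin 2)) (h₁ h₂ : ℝ) (hp₁ : 0 < h₁) (hp₂ : 0 < h₂) :
    |(h₁ * h₂)⁻¹ * (∫ y, μ y * (K ((x 0 - y 0) / h₁) * K ((x 1 - y 1) / h₂))) - μ x|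
      ≤ 2 * MK * (2 * MK * (L 0 * h₁ ^ β 0)) + 2 * MK * (L 1 * h₂ ^ β 1) := by
  obtain ⟨e, he, hep⟩ := mp_aux
  have hKi := K_int_aux K hK_meas MK hK_bdd hK_supp
  have hKs : ∀ (c h : ℝ), 0 < h → Integrable (fun a => K ((c - a) / h)) := by
    intro c h hh
    have h1 : Integrable (fun a => K (a / h)) := hKi.comp_div hh.ne'
    exact h1.comp_sub_left c
  have e1 : (∫ y, μ y * (K ((x 0 - y 0) / h₁) * K ((x 1 - y 1) / h₂)))
      = ∫ p : ℝ × ℝ, μ !₂[p.1, p.2] * (K ((x 0 - p.1) / h₁) * K ((x 1 - p.2) / h₂)) := by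
    rw [← he.integral_comp e.measurableEmbedding]
    simp [hep]
  have hm : Measurable fun p : ℝ × ℝ => μ !₂[p.1, p.2] := by
    have := hμ_meas.comp e.measurable
    simpa [Function.comp_def, hep] using this
  have hintg : Integrable (fun p : ℝ × ℝ => μ !₂[p.1, p.2] * (K ((x 0 - p.1) / h₁) * K ((x 1 - p.2) / h₂))) := by
    refine Integrable.bdd_mul (c := Cμ) ((hKs (x 0) h₁ hp₁).mul_prod (hKs (x 1) h₂ hp₂)) hm.aestronglyMeasurable
      (Filter.Eventually.of_forall fun p => by simpa using hb _)
  have hintg2 : Integrable (fun p : ℝ × ℝ => μ !₂[x 0 - h₁ * p.2, x 1 - h₂ * p.1] * (K p.1 * K p.2)) := by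
    refine Integrable.bdd_mul (c := Cμ) (hKi.mul_prod hKi) (Measurable.aestronglyMeasurable ?_)
      (Filter.Eventually.of_forall fun p => by simpa using hb _)
    exact hm.comp (g := fun p : ℝ × ℝ => μ !₂[p.1, p.2])
      (f := fun p : ℝ × ℝ => (x 0 - h₁ * p.2, x 1 - h₂ * p.1)) (by fun_prop)
  have e2 : (∫ y, μ y * (K ((x 0 - y 0) / h₁) * K ((x 1 - y 1) / h₂)))
      = h₁ * h₂ * ∫ v, K v * ∫ u, K u * μ !₂[x 0 - h₁ * u, x 1 - h₂ * v] := by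
    rw [e1, Measure.volume_eq_prod, integral_prod_symm _ hintg]
    rw [cov_1d _ (x 1) h₂ hp₂, mul_assoc, ← mul_assoc h₁, mul_comm h₁, mul_assoc, ← integral_const_mul h₁]
    congr 1
    apply integral_congr_ae
    refine Filter.Eventually.of_forall fun v => ?_
    simp only
    rw [cov_1d _ (x 0) h₁ hp₁]
    congr 1
    rw [← integral_const_mul]
    congr 1
    funext u
    have q1 : (x 0 - (x 0 - h₁ * u)) / h₁ = u := by field_simp; ring
    have q2 : (x 1 - (x 1 - h₂ * v)) / h₂ = v := by field_simp; ring
    simp only [q1, q2]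
    ring
  have hI : Integrable (fun v => K v * ∫ u, K u * μ !₂[x 0 - h₁ * u, x 1 - h₂ * v]) := by
    refine hintg2.integral_prod_left.congr (Filter.Eventually.of_forall fun v => ?_)
    simp only
    rw [← integral_const_mul]
    congr 1
    funext u
    ring
  have hs2 := slice_bias K hK_meas hK_int MK hK_bdd hK_supp M hK_mom β L hβ hL hM μ hμ_meas Cμ hb hH 1 x h₂ hp₂
  have v2 : ∀ v : ℝ, x + (-(h₂ * v)) • EuclideanSpace.single 1 1 = !₂[x 0, x 1 - h₂ * v] := by
    intro v
    ext j
    fin_cases j <;> simp; ring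
  simp only [v2] at hs2
  have hI2 : Integrable (fun v => K v * μ !₂[x 0, x 1 - h₂ * v]) := by
    refine hKi.mul_bdd (c := Cμ) (Measurable.aestronglyMeasurable ?_)
      (Filter.Eventually.of_forall fun p => by simpa using hb _)
    exact hm.comp (g := fun p : ℝ × ℝ => μ !₂[p.1, p.2])
      (f := fun v : ℝ => (x 0, x 1 - h₂ * v)) (by fun_prop)
  have e3 : (h₁ * h₂)⁻¹ * (∫ y, μ y * (K ((x 0 - y 0) / h₁) * K ((x 1 - y 1) / h₂))) - μ x
      = (∫ v, K v * ((∫ u, K u * μ !₂[x 0 - h₁ * u, x 1 - h₂ * v]) - μ !₂[x 0, x 1 - h₂ * v]))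
        + ((∫ v, K v * μ !₂[x 0, x 1 - h₂ * v]) - μ x) := by
    simp_rw [mul_sub]
    rw [integral_sub hI hI2, e2]
    field_simp
    ring
  rw [e3]
  refine (abs_add_le _ _).trans (add_le_add ?_ hs2)
  apply K_bound_aux K MK hK_bdd hK_supp
  intro v _
  have hs1 := slice_bias K hK_meas hK_int MK hK_bdd hK_supp M hK_mom β L hβ hL hM μ hμ_meas Cμ hb hH 0 !₂[x 0, x 1 - h₂ * v] h₁ hp₁
  have v1 : ∀ u : ℝ, !₂[x 0, x 1 - h₂ * v] + (-(h₁ * u)) • EuclideanSpace.single 0 1 = !₂[x 0 - h₁ * u, x 1 - h₂ * v] := by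
    intro u
    ext j
    fin_cases j <;> simp; ring
  simp only [v1] at hs1
  exact hs1

lemma Z_aux {Ω : Type*} [MeasurableSpace Ω] (P : Measure Ω) [IsProbabilityMeasure P]
    (X : ℝ → Ω → EuclideanSpace ℝ (Fin 2))
    (hX : Measurable (Function.uncurry X))
    (f : EuclideanSpace ℝ (Fin 2) → ℝ) (hf : Measurable f) (Mf : ℝ) (hMf : ∀ x, |f x| ≤ Mf)
    (T : ℝ) (hT : 0 < T) :
    Measurable (fun ω => ∫ t in Set.Icc 0 T, f (X t ω)) ∧
    (∀ ω, |∫ t in Set.Icc 0 T, f (X t ω)| ≤ Mf * T) ∧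
    (∀ ω, IntegrableOn (fun t => f (X t ω)) (Set.Icc 0 T)) := by
  have hj : Measurable (fun p : Ω × ℝ => f (X p.2 p.1)) :=
    hf.comp (hX.comp measurable_swap)
  refine ⟨?_, ?_, ?_⟩
  · exact (hj.stronglyMeasurable.integral_prod_right (ν := volume.restrict (Set.Icc 0 T))).measurable
  · intro ω
    have := norm_setIntegral_le_of_norm_le_const (μ := volume) (s := Set.Icc (0 : ℝ) T)
      (f := fun t => f (X t ω)) (C := Mf) (by simp) (fun t _ => by simpa using hMf _)
    simpa [Measure.real, hT.le] using this
  · intro ω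
    exact Measure.integrableOn_of_bounded (M := Mf) (by simp)
      (hj.comp measurable_prodMk_left).aestronglyMeasurable
      (Filter.Eventually.of_forall fun x => by simpa using hMf _)

lemma E_aux {Ω : Type*} [MeasurableSpace Ω] (P : Measure Ω) [IsProbabilityMeasure P]
    (X : ℝ → Ω → EuclideanSpace ℝ (Fin 2))
    (hX : Measurable (Function.uncurry X))
    (hstat : ∀ (n : ℕ) (t : Fin n → ℝ) (s : ℝ), 0 ≤ s → (∀ i, 0 ≤ t i) →
      P.map (fun ω i => X (t i + s) ω) = P.map (fun ω i => X (t i) ω))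
    (μ : EuclideanSpace ℝ (Fin 2) → ℝ) (hμ_meas : Measurable μ)
    (hμ_nonneg : ∀ x, 0 ≤ μ x)
    (hμ_density : P.map (X 0) = volume.withDensity (fun x => ENNReal.ofReal (μ x)))
    (f : EuclideanSpace ℝ (Fin 2) → ℝ) (hf : Measurable f) (Mf : ℝ) (hMf : ∀ x, |f x| ≤ Mf)
    (T : ℝ) (hT : 0 < T) :
    ∫ ω, (∫ t in Set.Icc 0 T, f (X t ω)) ∂P = T * ∫ y, μ y * f y := by
  have hXt : ∀ t, Measurable (X t) := fun t => hX.comp measurable_prodMk_left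
  have hj : Measurable (fun p : Ω × ℝ => f (X p.2 p.1)) :=
    hf.comp (hX.comp measurable_swap)
  have hlaw : ∀ t, 0 ≤ t → P.map (X t) = P.map (X 0) := by
    intro t ht
    have h := hstat 1 (fun _ => 0) t ht (fun _ => le_rfl)
    have h' := congrArg (fun ν => Measure.map (fun g : Fin 1 → EuclideanSpace ℝ (Fin 2) => g 0) ν) h
    rw [Measure.map_map (measurable_pi_apply 0) (measurable_pi_lambda _ fun _ => hXt _),
      Measure.map_map (measurable_pi_apply 0) (measurable_pi_lambda _ fun _ => hXt _)] at h'
    simpa [Function.comp_def] using h'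
  have hE : ∀ t, 0 ≤ t → ∫ ω, f (X t ω) ∂P = ∫ y, μ y * f y := by
    intro t ht
    rw [← integral_map (hXt t).aemeasurable hf.aestronglyMeasurable, hlaw t ht, hμ_density,
      integral_withDensity_eq_integral_toReal_smul (by fun_prop) (by simp)]
    simp [ENNReal.toReal_ofReal, hμ_nonneg]
  rw [integral_integral_swap]
  · rw [setIntegral_congr_fun (g := fun _ => ∫ y, μ y * f y) measurableSet_Icc (fun t ht => hE t ht.1)]
    simp [Measure.real, hT.le]
  · exact (integrable_const Mf).mono' hj.aestronglyMeasurable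
      (Filter.Eventually.of_forall fun x => by simpa [Function.uncurry] using hMf _)

lemma vol_aux (a b c d : ℝ) (S : Set (EuclideanSpace ℝ (Fin 2)))
    (hS : ∀ y ∈ S, y 0 ∈ Set.Icc a b ∧ y 1 ∈ Set.Icc c d) :
    volume S ≤ ENNReal.ofReal (b - a) * ENNReal.ofReal (d - c) := by
  obtain ⟨e, he, hep⟩ := mp_aux
  rw [← he.measure_preimage_equiv]
  calc volume (e ⁻¹' S) ≤ volume (Set.Icc a b ×ˢ Set.Icc c d) := by
        apply measure_mono
        intro p hp
        have := hS _ hp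
        simp only [hep] at this
        exact ⟨by simpa using this.1, by simpa using this.2⟩
    _ = _ := by rw [Measure.volume_eq_prod, Measure.prod_prod, Real.volume_Icc, Real.volume_Icc]

lemma var_aux (V C₀ T Mf A : ℝ) (S : Set (EuclideanSpace ℝ (Fin 2))) (hT : 0 < T) (hA : 0 < A) (hA1 : A ≤ 1 / 2)
    (hS : volume S ≤ ENNReal.ofReal A)
    (hV : volume S < 1 → V ≤ C₀ * T * Mf ^ 2 * (volume S).toReal ^ 2 *
          (1 + Real.log (1 / (volume S).toReal))) :
    V ≤ |C₀| * T * Mf ^ 2 * (A ^ 2 * (1 + Real.log (1 / A))) := by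
  have h1 : volume S < 1 := by
    refine hS.trans_lt ?_
    rw [ENNReal.ofReal_lt_one]
    linarith
  have hsA : (volume S).toReal ≤ A := ENNReal.toReal_le_of_le_ofReal hA.le hS
  have hs0 : 0 ≤ (volume S).toReal := ENNReal.toReal_nonneg
  have h2 := log_aux _ A hs0 hA hsA (by linarith)
  refine (hV h1).trans ?_
  have hl : 0 ≤ (volume S).toReal ^ 2 * (1 + Real.log (1 / (volume S).toReal)) := by
    have : 0 ≤ Real.log (1 / (volume S).toReal) := by
      rw [one_div, Real.log_inv]
      have := Real.log_nonpos hs0 (by linarith)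
      linarith
    positivity
  calc _ = C₀ * (T * Mf ^ 2 * ((volume S).toReal ^ 2 * (1 + Real.log (1 / (volume S).toReal)))) := by ring
    _ ≤ |C₀| * (T * Mf ^ 2 * ((volume S).toReal ^ 2 * (1 + Real.log (1 / (volume S).toReal)))) := by
      apply mul_le_mul_of_nonneg_right (le_abs_self _)
      positivity
    _ ≤ |C₀| * (T * Mf ^ 2 * (A ^ 2 * (1 + Real.log (1 / A)))) := by gcongr
    _ = _ := by ring

set_option maxHeartbeats 2000000 in
/-- Pointwise convergence rate for the kernel invariant-density
estimator, case `d = 2`: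
(i) `E|μ̂_{h,T}(x)-μ(x)|² ≤ C(h₁^{2β₁} + h₂^{2β₂} + T⁻¹(1 + log(1/(h₁h₂))))`;
(ii) with `h_i = T^{-a_i}`, `2a_iβ_i > 1`, the risk is `≤ C (log T)/T` for all large `T`. -/
theorem stmt17 {Ω : Type*} [MeasurableSpace Ω] (P : Measure Ω) [IsProbabilityMeasure P]
    (β L : Fin 2 → ℝ) (hβ : ∀ i, 0 < β i) (hL : ∀ i, 0 < L i)
    (X : ℝ → Ω → EuclideanSpace ℝ (Fin 2))
    (hX : Measurable (Function.uncurry X))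
    (hstat : ∀ (n : ℕ) (t : Fin n → ℝ) (s : ℝ), 0 ≤ s → (∀ i, 0 ≤ t i) →
      P.map (fun ω i => X (t i + s) ω) = P.map (fun ω i => X (t i) ω))
    (μ : EuclideanSpace ℝ (Fin 2) → ℝ) (hμ_meas : Measurable μ)
    (hμ_nonneg : ∀ x, 0 ≤ μ x) (Cμ : ℝ) (hμ_bdd : ∀ x, μ x ≤ Cμ)
    (hμ_density : P.map (X 0) = volume.withDensity (fun x => ENNReal.ofReal (μ x)))
    (hμ_holder : memHolder 2 β L μ)
    (C₀ : ℝ)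
    (hvar : ∀ T > (0 : ℝ), ∀ f : EuclideanSpace ℝ (Fin 2) → ℝ, ∀ Mf : ℝ,
      Measurable f → (∀ x, |f x| ≤ Mf) → volume (Function.support f) < 1 →
      (∫ ω, ((∫ t in Set.Icc 0 T, f (X t ω))
          - ∫ ω', (∫ t in Set.Icc 0 T, f (X t ω')) ∂P) ^ 2 ∂P)
        ≤ C₀ * T * Mf ^ 2 * (volume (Function.support f)).toReal ^ 2 *
          (1 + Real.log (1 / (volume (Function.support f)).toReal)))
    (K : ℝ → ℝ) (hK_meas : Measurable K) (hK_int : ∫ x, K x = 1)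
    (MK : ℝ) (hK_bdd : ∀ x, |K x| ≤ MK)
    (hK_supp : Function.support K ⊆ Set.Icc (-1) 1)
    (M : ℕ) (hM : ∀ i, β i ≤ (M : ℝ))
    (hK_mom : ∀ l : ℕ, 1 ≤ l → l ≤ M → ∫ x, K x * x ^ l = 0) :
    ∃ C : ℝ,
      (∀ (x : EuclideanSpace ℝ (Fin 2)) (T h₁ h₂ : ℝ), 0 < T →
        h₁ ∈ Set.Ioc (0 : ℝ) (1 / 2) → h₂ ∈ Set.Ioc (0 : ℝ) (1 / 2) →
        (∫ ω, ((1 / (T * h₁ * h₂)) *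
            (∫ u in Set.Icc 0 T, K ((x 0 - X u ω 0) / h₁) * K ((x 1 - X u ω 1) / h₂))
            - μ x) ^ 2 ∂P)
          ≤ C * (h₁ ^ (2 * β 0) + h₂ ^ (2 * β 1)
            + T⁻¹ * (1 + Real.log (1 / (h₁ * h₂))))) ∧
      (∀ a₁ ∈ Set.Ioc (0 : ℝ) 1, ∀ a₂ ∈ Set.Ioc (0 : ℝ) 1,
        2 * a₁ * β 0 > 1 → 2 * a₂ * β 1 > 1 →
        ∃ T₀ : ℝ, ∀ T ≥ T₀, ∀ x : EuclideanSpace ℝ (Fin 2),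
          (∫ ω, ((1 / (T * T ^ (-a₁) * T ^ (-a₂))) *
              (∫ u in Set.Icc 0 T,
                K ((x 0 - X u ω 0) / T ^ (-a₁)) * K ((x 1 - X u ω 1) / T ^ (-a₂)))
              - μ x) ^ 2 ∂P)
            ≤ C * Real.log T / T) := by
  have hMK : 0 ≤ MK := (abs_nonneg _).trans (hK_bdd 0)
  have hb : ∀ x, |μ x| ≤ Cμ := fun x => by rw [abs_of_nonneg (hμ_nonneg x)]; exact hμ_bdd x
  set D : ℝ := 24 * |C₀| * MK ^ 4 + 6 * (2 * MK * (2 * MK * L 0)) ^ 2 + 6 * (2 * MK * L 1) ^ 2 with hD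
  have hD0 : 0 ≤ D := by positivity
  have part1 : ∀ (x : EuclideanSpace ℝ (Fin 2)) (T h₁ h₂ : ℝ), 0 < T →
        h₁ ∈ Set.Ioc (0 : ℝ) (1 / 2) → h₂ ∈ Set.Ioc (0 : ℝ) (1 / 2) →
        (∫ ω, ((1 / (T * h₁ * h₂)) *
            (∫ u in Set.Icc 0 T, K ((x 0 - X u ω 0) / h₁) * K ((x 1 - X u ω 1) / h₂))
            - μ x) ^ 2 ∂P)
          ≤ D * (h₁ ^ (2 * β 0) + h₂ ^ (2 * β 1)
            + T⁻¹ * (1 + Real.log (1 / (h₁ * h₂)))) := by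
    intro x T h₁ h₂ hT hh₁ hh₂
    obtain ⟨hp₁, hl₁⟩ := hh₁
    obtain ⟨hp₂, hl₂⟩ := hh₂
    set f : EuclideanSpace ℝ (Fin 2) → ℝ := fun y => K ((x 0 - y 0) / h₁) * K ((x 1 - y 1) / h₂) with hf
    have hfm : Measurable f := by
      refine (hK_meas.comp ?_).mul (hK_meas.comp ?_) <;> fun_prop
    have hfb : ∀ y, |f y| ≤ MK ^ 2 := fun y => by
      rw [hf, abs_mul, sq]
      exact mul_le_mul (hK_bdd _) (hK_bdd _) (abs_nonneg _) hMK
    set A : Set (EuclideanSpace ℝ (Fin 2)) := {y | y 0 ≤ x 0} with hA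
    have hAm : MeasurableSet A := measurableSet_le (by fun_prop) measurable_const
    set f₁ := A.indicator f with hf₁
    set f₂ := Aᶜ.indicator f with hf₂
    have hff : ∀ y, f y = f₁ y + f₂ y := fun y => by
      rw [hf₁, hf₂, ← Pi.add_apply, Set.indicator_self_add_compl]
    have hf₁m : Measurable f₁ := hfm.indicator hAm
    have hf₂m : Measurable f₂ := hfm.indicator hAm.compl
    have hf₁b : ∀ y, |f₁ y| ≤ MK ^ 2 := fun y => by
      have := norm_indicator_le_norm_self (s := A) f y
      simp only [Real.norm_eq_abs] at this
      exact this.trans (hfb y)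
    have hf₂b : ∀ y, |f₂ y| ≤ MK ^ 2 := fun y => by
      have := norm_indicator_le_norm_self (s := Aᶜ) f y
      simp only [Real.norm_eq_abs] at this
      exact this.trans (hfb y)
    have hmem : ∀ y, f y ≠ 0 → (y 0 ∈ Set.Icc (x 0 - h₁) (x 0 + h₁) ∧ y 1 ∈ Set.Icc (x 1 - h₂) (x 1 + h₂)) := by
      intro y hy
      have k1 := hK_supp (left_ne_zero_of_mul hy)
      have k2 := hK_supp (right_ne_zero_of_mul hy)
      rw [Set.mem_Icc, le_div_iff₀ hp₁, div_le_iff₀ hp₁] at k1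
      rw [Set.mem_Icc, le_div_iff₀ hp₂, div_le_iff₀ hp₂] at k2
      refine ⟨⟨?_, ?_⟩, ⟨?_, ?_⟩⟩ <;> linarith [k1.1, k1.2, k2.1, k2.2]
    have hq : 0 < 2 * h₁ * h₂ := by positivity
    have hq1 : 2 * h₁ * h₂ ≤ 1 / 2 := by nlinarith
    have hS₁ : volume (Function.support f₁) ≤ ENNReal.ofReal (2 * h₁ * h₂) := by
      have := vol_aux (x 0 - h₁) (x 0) (x 1 - h₂) (x 1 + h₂) (Function.support f₁) (by
        intro y hy
        rw [hf₁, Set.support_indicator] at hy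
        have := hmem y hy.2
        exact ⟨⟨this.1.1, hy.1⟩, this.2⟩)
      rw [← ENNReal.ofReal_mul (by linarith)] at this
      convert this using 2
      ring
    have hS₂ : volume (Function.support f₂) ≤ ENNReal.ofReal (2 * h₁ * h₂) := by
      have := vol_aux (x 0) (x 0 + h₁) (x 1 - h₂) (x 1 + h₂) (Function.support f₂) (by
        intro y hy
        rw [hf₂, Set.support_indicator] at hy
        have := hmem y hy.2
        have h3 : ¬ (y 0 ≤ x 0) := hy.1
        exact ⟨⟨(not_le.1 h3).le, this.1.2⟩, this.2⟩)
      rw [← ENNReal.ofReal_mul (by linarith)] at this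
      convert this using 2
      ring
    have hV₁ := var_aux _ C₀ T (MK ^ 2) _ _ hT hq hq1 hS₁ (hvar T hT f₁ (MK ^ 2) hf₁m hf₁b)
    have hV₂ := var_aux _ C₀ T (MK ^ 2) _ _ hT hq hq1 hS₂ (hvar T hT f₂ (MK ^ 2) hf₂m hf₂b)
    obtain ⟨z1m, z1b, z1i⟩ := Z_aux P X hX f₁ hf₁m _ hf₁b T hT
    obtain ⟨z2m, z2b, z2i⟩ := Z_aux P X hX f₂ hf₂m _ hf₂b T hT
    have hE := E_aux P X hX hstat μ hμ_meas hμ_nonneg hμ_density f hfm _ hfb T hT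
    have hZ : ∀ ω, ∫ t in Set.Icc 0 T, f (X t ω) =
        (∫ t in Set.Icc 0 T, f₁ (X t ω)) + ∫ t in Set.Icc 0 T, f₂ (X t ω) := by
      intro ω
      rw [← integral_add (z1i ω) (z2i ω)]
      simp only [hff]
    set Z₁ : Ω → ℝ := fun ω => ∫ t in Set.Icc 0 T, f₁ (X t ω) with hZ₁
    set Z₂ : Ω → ℝ := fun ω => ∫ t in Set.Icc 0 T, f₂ (X t ω) with hZ₂
    have z1I : Integrable Z₁ P := (integrable_const (MK ^ 2 * T)).mono' z1m.aestronglyMeasurable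
      (Filter.Eventually.of_forall z1b)
    have z2I : Integrable Z₂ P := (integrable_const (MK ^ 2 * T)).mono' z2m.aestronglyMeasurable
      (Filter.Eventually.of_forall z2b)
    have hE' : (∫ ω, Z₁ ω ∂P) + (∫ ω, Z₂ ω ∂P) = T * ∫ y, μ y * f y := by
      rw [← integral_add z1I z2I, ← hE]
      exact integral_congr_ae (Filter.Eventually.of_forall fun ω => (hZ ω).symm)
    set e₁ := ∫ ω, Z₁ ω ∂P with he₁
    set e₂ := ∫ ω, Z₂ ω ∂P with he₂
    have sqI : ∀ (Z : Ω → ℝ) (e : ℝ), Measurable Z → (∀ ω, |Z ω| ≤ MK ^ 2 * T) →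
        Integrable (fun ω => (Z ω - e) ^ 2) P := by
      intro Z e hm hB
      refine (integrable_const ((MK ^ 2 * T + |e|) ^ 2)).mono' (by fun_prop)
        (Filter.Eventually.of_forall fun ω => ?_)
      rw [Real.norm_eq_abs, abs_pow]
      have : |Z ω - e| ≤ MK ^ 2 * T + |e| := (abs_sub _ _).trans (by linarith [hB ω])
      gcongr
    have q1I := sqI Z₁ e₁ z1m z1b
    have q2I := sqI Z₂ e₂ z2m z2b
    set c := 1 / (T * h₁ * h₂) with hc
    set b := c * (e₁ + e₂) - μ x with hbdef
    have hbias : |b| ≤ 2 * MK * (2 * MK * (L 0 * h₁ ^ β 0)) + 2 * MK * (L 1 * h₂ ^ β 1) := by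
      have := bias_2d K hK_meas hK_int MK hK_bdd hK_supp M hK_mom β L hβ hL hM μ hμ_meas Cμ hb
        hμ_holder x h₁ h₂ hp₁ hp₂
      have e : b = (h₁ * h₂)⁻¹ * (∫ y, μ y * (K ((x 0 - y 0) / h₁) * K ((x 1 - y 1) / h₂))) - μ x := by
        rw [hbdef, hE', hc, hf]
        congr 1
        field_simp
      rw [e]
      exact this
    have step : (∫ ω, (c * (∫ u in Set.Icc 0 T, f (X u ω)) - μ x) ^ 2 ∂P)
        ≤ ∫ ω, (3 * c ^ 2 * (Z₁ ω - e₁) ^ 2 + 3 * c ^ 2 * (Z₂ ω - e₂) ^ 2 + 3 * b ^ 2) ∂P := by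
      apply integral_mono_of_nonneg (Filter.Eventually.of_forall fun ω => sq_nonneg _)
      · exact ((q1I.const_mul _).add (q2I.const_mul _)).add (integrable_const _)
      · refine Filter.Eventually.of_forall fun ω => ?_
        simp only [hZ]
        have e : c * (Z₁ ω + Z₂ ω) - μ x = c * (Z₁ ω - e₁) + c * (Z₂ ω - e₂) + b := by
          rw [hbdef]; ring
        have : (c * (Z₁ ω + Z₂ ω) - μ x) ^ 2 ≤ 3 * c ^ 2 * (Z₁ ω - e₁) ^ 2 + 3 * c ^ 2 * (Z₂ ω - e₂) ^ 2 + 3 * b ^ 2 := by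
          rw [e]
          nlinarith [sq_nonneg (c * (Z₁ ω - e₁) - c * (Z₂ ω - e₂)), sq_nonneg (c * (Z₁ ω - e₁) - b),
            sq_nonneg (c * (Z₂ ω - e₂) - b)]
        exact this
    refine step.trans ?_
    have q12 : Integrable (fun ω => 3 * c ^ 2 * (Z₁ ω - e₁) ^ 2 + 3 * c ^ 2 * (Z₂ ω - e₂) ^ 2) P :=
      (q1I.const_mul _).add (q2I.const_mul _)
    rw [integral_add q12 (integrable_const _),
      integral_add (q1I.const_mul _) (q2I.const_mul _), integral_const_mul, integral_const_mul]
    simp only [integral_const, probReal_univ, one_smul]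
    have hlog : Real.log (1 / (2 * h₁ * h₂)) ≤ Real.log (1 / (h₁ * h₂)) := by
      apply Real.log_le_log (by positivity)
      apply one_div_le_one_div_of_le (by positivity)
      nlinarith [mul_pos hp₁ hp₂]
    have hlog0 : 0 ≤ Real.log (1 / (h₁ * h₂)) := by
      apply Real.log_nonneg
      rw [le_div_iff₀ (by positivity)]
      nlinarith
    set ℓ := Real.log (1 / (h₁ * h₂)) with hℓ
    have hVb : ∀ V, V ≤ |C₀| * T * (MK ^ 2) ^ 2 * ((2 * h₁ * h₂) ^ 2 * (1 + Real.log (1 / (2 * h₁ * h₂)))) →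
        3 * c ^ 2 * V ≤ 12 * |C₀| * MK ^ 4 * (T⁻¹ * (1 + ℓ)) := by
      intro V hV
      calc 3 * c ^ 2 * V ≤ 3 * c ^ 2 * (|C₀| * T * (MK ^ 2) ^ 2 * ((2 * h₁ * h₂) ^ 2 * (1 + ℓ))) := by
            apply mul_le_mul_of_nonneg_left (hV.trans _) (by positivity)
            gcongr
        _ = _ := by
            rw [hc]
            field_simp
            ring
    have hb2 : 3 * b ^ 2 ≤ 6 * (2 * MK * (2 * MK * L 0)) ^ 2 * h₁ ^ (2 * β 0) + 6 * (2 * MK * L 1) ^ 2 * h₂ ^ (2 * β 1) := by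
      have r1 : h₁ ^ (2 * β 0) = (h₁ ^ β 0) ^ 2 := by
        rw [mul_comm, Real.rpow_mul hp₁.le, Real.rpow_two]
      have r2 : h₂ ^ (2 * β 1) = (h₂ ^ β 1) ^ 2 := by
        rw [mul_comm, Real.rpow_mul hp₂.le, Real.rpow_two]
      rw [r1, r2]
      have := pow_le_pow_left₀ (abs_nonneg b) hbias 2
      rw [sq_abs] at this
      nlinarith [sq_nonneg (2 * MK * (2 * MK * (L 0 * h₁ ^ β 0)) - 2 * MK * (L 1 * h₂ ^ β 1))]
    have w1 := hVb _ hV₁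
    have w2 := hVb _ hV₂
    have n1 : 0 ≤ h₁ ^ (2 * β 0) := by positivity
    have n2 : 0 ≤ h₂ ^ (2 * β 1) := by positivity
    have n3 : 0 ≤ T⁻¹ * (1 + ℓ) := by positivity
    have d0 : 0 ≤ |C₀| * MK ^ 4 := by positivity
    have d1 : 6 * (2 * MK * (2 * MK * L 0)) ^ 2 ≤ D := by
      rw [hD]; nlinarith [sq_nonneg (2 * MK * L 1)]
    have d2 : 6 * (2 * MK * L 1) ^ 2 ≤ D := by
      rw [hD]; nlinarith [sq_nonneg (2 * MK * (2 * MK * L 0))]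
    have d3 : 24 * |C₀| * MK ^ 4 ≤ D := by
      rw [hD]; nlinarith [sq_nonneg (2 * MK * (2 * MK * L 0)), sq_nonneg (2 * MK * L 1)]
    have := mul_le_mul_of_nonneg_right d1 n1
    have := mul_le_mul_of_nonneg_right d2 n2
    have := mul_le_mul_of_nonneg_right d3 n3
    calc _ ≤ 12 * |C₀| * MK ^ 4 * (T⁻¹ * (1 + ℓ)) + 12 * |C₀| * MK ^ 4 * (T⁻¹ * (1 + ℓ)) +
          (6 * (2 * MK * (2 * MK * L 0)) ^ 2 * h₁ ^ (2 * β 0) + 6 * (2 * MK * L 1) ^ 2 * h₂ ^ (2 * β 1)) :=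
          add_le_add (add_le_add w1 w2) hb2
      _ ≤ _ := by linarith
  refine ⟨5 * D, ?_, ?_⟩
  · intro x T h₁ h₂ hT hh₁ hh₂
    refine (part1 x T h₁ h₂ hT hh₁ hh₂).trans ?_
    have hp₁ := hh₁.1
    have hp₂ := hh₂.1
    have hlog0 : 0 ≤ Real.log (1 / (h₁ * h₂)) := by
      apply Real.log_nonneg
      rw [le_div_iff₀ (by positivity)]
      nlinarith [hh₁.2, hh₂.2]
    apply mul_le_mul_of_nonneg_right (by linarith)
    positivity
  · intro a₁ ha₁ a₂ ha₂ h1 h2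
    have ev : ∀ a : ℝ, 0 < a → ∀ᶠ T : ℝ in Filter.atTop, T ^ (-a) ≤ 1 / 2 := fun a ha =>
      (tendsto_rpow_neg_atTop ha).eventually_le_const (by norm_num)
    obtain ⟨T₀, hT₀⟩ := Filter.eventually_atTop.1
      ((ev a₁ ha₁.1).and ((ev a₂ ha₂.1).and (Filter.eventually_ge_atTop (Real.exp 1))))
    refine ⟨T₀, fun T hT x => ?_⟩
    obtain ⟨t1, t2, t3⟩ := hT₀ T hT
    have hTp : 0 < T := (Real.exp_pos 1).trans_le t3
    have hT1 : 1 ≤ T := by linarith [Real.add_one_le_exp 1]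
    have hlT : 1 ≤ Real.log T := by rwa [Real.le_log_iff_exp_le hTp]
    refine (part1 x T _ _ hTp ⟨by positivity, t1⟩ ⟨by positivity, t2⟩).trans ?_
    have r : ∀ a b : ℝ, 2 * a * b > 1 → (T ^ (-a)) ^ (2 * b) ≤ T⁻¹ := by
      intro a b hab
      rw [← Real.rpow_mul hTp.le, ← Real.rpow_neg_one]
      exact Real.rpow_le_rpow_of_exponent_le hT1 (by linarith)
    have hlog : Real.log (1 / (T ^ (-a₁) * T ^ (-a₂))) ≤ 2 * Real.log T := by
      rw [one_div, Real.log_inv, ← Real.rpow_add hTp, Real.log_rpow hTp]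
      nlinarith [ha₁.2, ha₂.2]
    have hi : 0 < T⁻¹ := by positivity
    have r1 := r _ _ h1
    have r2 := r _ _ h2
    have : (T ^ (-a₁)) ^ (2 * β 0) + (T ^ (-a₂)) ^ (2 * β 1)
        + T⁻¹ * (1 + Real.log (1 / (T ^ (-a₁) * T ^ (-a₂)))) ≤ 5 * (Real.log T / T) := by
      rw [div_eq_mul_inv (Real.log T) T]
      nlinarith [mul_le_mul_of_nonneg_left hlog hi.le, mul_le_mul_of_nonneg_left hlT hi.le]
    calc _ ≤ D * (5 * (Real.log T / T)) := mul_le_mul_of_nonneg_left this hD0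
      _ = _ := by ring
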